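/- arXiv:2305.09611 — 3 statements merged into one kernel-verified Lean document; each statement's English description precedes it below -/
import Mathlib

section
/- (Ellentuck's theorem, part 1.) Let [ℕ]^ω carry the Ellentuck topology. For any set 𝒜 ⊆ [ℕ]^ω the following are equivalent: (a) 𝒜 is Ramsey null; (b) 𝒜 is nowhere dense in the Ellentuck topology; (c) 𝒜 is meager in the Ellentuck topology. -/
open scoped Topology

namespace Ellentuck

/-- `[ℕ]^ω`, the set of infinite subsets of `ℕ`. -/
abbrev InfSet : Type := {A : Set ℕ // A.Infinite}

/-- `s ⊏ A` : the finite set `s` is an initial segment of `A`,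
i.e. `s = {n ∈ A : n ≤ max s}` (which for `s = ∅` says `s = ∅`). -/
def InitSeg (s : Finset ℕ) (A : Set ℕ) : Prop :=
  (s : Set ℕ) = {n | n ∈ A ∧ (n : WithBot ℕ) ≤ s.max}

/-- The Ellentuck basic set `[s, B] = {A ∈ [ℕ]^ω : A ⊆ B ∧ s ⊏ A}`. -/
def seg (s : Finset ℕ) (B : InfSet) : Set InfSet :=
  {A | A.1 ⊆ B.1 ∧ InitSeg s A.1}

/-- Basic open sets of the Ellentuck topology. -/
def IsBasic (U : Set InfSet) : Prop := ∃ (s : Finset ℕ) (B : InfSet), U = seg s B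

/-- The Ellentuck topology on `[ℕ]^ω`, generated by the sets `[s,B]`. -/
def ellentuckTop : TopologicalSpace InfSet :=
  TopologicalSpace.generateFrom {U | IsBasic U}

/-- `𝒩` is nowhere dense: every nonempty basic open set contains a nonempty basic open
subset disjoint from `𝒩`. -/
def Nwd (X : Set InfSet) : Prop :=
  ∀ U : Set InfSet, IsBasic U → U.Nonempty →
    ∃ V : Set InfSet, IsBasic V ∧ V.Nonempty ∧ V ⊆ U ∧ V ∩ X = ∅

/-- `𝒳` is meager: a countable union of nowhere dense sets. -/
def Meager (X : Set InfSet) : Prop :=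
  ∃ f : ℕ → Set InfSet, (∀ i, Nwd (f i)) ∧ X = ⋃ i, f i

/-- `𝒳` has the abstract Baire property. -/
def ABP (X : Set InfSet) : Prop :=
  ∀ U : Set InfSet, IsBasic U → U.Nonempty →
    ∃ V : Set InfSet, IsBasic V ∧ V.Nonempty ∧ V ⊆ U ∧ (V ⊆ X ∨ V ∩ X = ∅)

/-- `𝒳` has the Baire property: `𝒳 △ 𝒪` is meager for some open set `𝒪` of the
Ellentuck topology. -/
def BP (X : Set InfSet) : Prop :=
  ∃ O : Set InfSet, IsOpen[ellentuckTop] O ∧ Meager (symmDiff X O)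

/-- `𝒜 ⊆ [ℕ]^ω` is Ramsey. -/
def IsRamsey (X : Set InfSet) : Prop :=
  ∀ (N : InfSet) (s : Finset ℕ), (s : Set ℕ) ⊆ N.1 →
    ∃ M : InfSet, M.1 ⊆ N.1 ∧ (s : Set ℕ) ⊆ M.1 ∧ (seg s M ⊆ X ∨ seg s M ∩ X = ∅)

/-- `𝒜 ⊆ [ℕ]^ω` is Ramsey null. -/
def IsRamseyNull (X : Set InfSet) : Prop :=
  ∀ (N : InfSet) (s : Finset ℕ), (s : Set ℕ) ⊆ N.1 →
    ∃ M : InfSet, M.1 ⊆ N.1 ∧ (s : Set ℕ) ⊆ M.1 ∧ seg s M ∩ X = ∅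

/-- No member of `X` is of the form `t ∪ C` with `C ⊆ M` and `C` entirely above `t`. -/
def Avoids (X : Set InfSet) (t : Finset ℕ) (M : Set ℕ) : Prop :=
  ∀ A ∈ X, (t : Set ℕ) ⊆ A.1 → ¬ ∀ a ∈ A.1, a ∈ t ∨ (a ∈ M ∧ ∀ x ∈ t, x < a)

/-- No infinite subset of `M` is avoided, relative to the stem `t`. -/
def Rejects (X : Set InfSet) (t : Finset ℕ) (M : Set ℕ) : Prop :=
  ∀ M' ⊆ M, M'.Infinite → ¬ Avoids X t M'

/-- The part of `M` lying strictly above the finite set `t`. -/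
def above (t : Finset ℕ) (M : Set ℕ) : Set ℕ := {a ∈ M | ∀ x ∈ t, x < a}

theorem above_infinite (t : Finset ℕ) {M : Set ℕ} (hM : M.Infinite) : (above t M).Infinite := by
  refine (hM.sdiff (Set.finite_Iic (t.sup id))).mono fun a ha => ⟨ha.1, fun x hx => ?_⟩
  have h1 : x ≤ t.sup id := Finset.le_sup (f := id) hx
  have h2 := ha.2
  simp only [Set.mem_Iic] at h2
  omega

theorem Avoids.mono {X : Set InfSet} {t : Finset ℕ} {M M' : Set ℕ} (h : Avoids X t M)
    (hM : above t M' ⊆ M) : Avoids X t M' := by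
  intro A hA ht hall
  refine h A hA ht fun a ha => ?_
  rcases hall a ha with h1 | h1
  · exact .inl h1
  · exact .inr ⟨hM h1, h1.2⟩

theorem Rejects.mono {X : Set InfSet} {t : Finset ℕ} {M M' : Set ℕ} (h : Rejects X t M)
    (hM : above t M' ⊆ M) : Rejects X t M' := by
  intro K hK hKi hKa
  exact h (above t K) (fun a ha => hM ⟨hK ha.1, ha.2⟩) (above_infinite t hKi)
    (hKa.mono fun a ha => ha.1.1)

theorem above_subset (t : Finset ℕ) (M : Set ℕ) : above t M ⊆ M := fun _ ha => ha.1

/-- Finitely many hereditary dense properties can be met simultaneously. -/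
theorem exists_forall_finset {ι : Type*} (Q : ι → Set ℕ → Prop)
    (her : ∀ i M M', Q i M → M' ⊆ M → Q i M')
    (dense : ∀ i M, M.Infinite → ∃ M' ⊆ M, M'.Infinite ∧ Q i M')
    (T : Finset ι) (M : Set ℕ) (hM : M.Infinite) :
    ∃ M' ⊆ M, M'.Infinite ∧ ∀ i ∈ T, Q i M' := by
  classical
  induction T using Finset.induction_on with
  | empty => exact ⟨M, subset_rfl, hM, by simp⟩
  | insert i T _ ih =>
    obtain ⟨K, hKM, hK, hKT⟩ := ih
    obtain ⟨L, hLK, hL, hLi⟩ := dense i K hK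
    refine ⟨L, hLK.trans hKM, hL, fun j hj => ?_⟩
    rcases Finset.mem_insert.1 hj with rfl | hj
    · exact hLi
    · exact her _ _ _ (hKT j hj) hLK

/-- Fusion: a sequence of hereditary dense properties can be met by the tails of one set. -/
theorem fusion (P : ℕ → Set ℕ → Prop)
    (her : ∀ n M M', P n M → M' ⊆ M → P n M')
    (dense : ∀ n M, M.Infinite → ∃ M' ⊆ M, M'.Infinite ∧ P n M')
    (k : ℕ) (N : Set ℕ) (hN : N.Infinite) :
    ∃ M ⊆ N, M.Infinite ∧ P k M ∧ ∀ m ∈ M, P (m + 1) (M ∩ Set.Ioi m) := by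
  choose! F hFsub hFinf hFP using dense
  let pick : Set ℕ → ℕ := sInf
  let next : Set ℕ → Set ℕ := fun K => F (pick K + 1) K ∩ Set.Ioi (pick K)
  let S : ℕ → Set ℕ := fun n => next^[n] (F k N)
  have hS (n) : S (n + 1) = next (S n) := Function.iterate_succ_apply' _ _ _
  have hinf (n) : (S n).Infinite := by
    induction n with
    | zero => exact hFinf k N hN
    | succ n ih =>
      rw [hS]
      refine ((hFinf (pick (S n) + 1) _ ih).sdiff (Set.finite_Iic (pick (S n)))).mono ?_
      intro a ha
      exact ⟨ha.1, Set.mem_Ioi.2 (not_le.1 ha.2)⟩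
  have hanti : Antitone S := antitone_nat_of_succ_le fun n => by
    rw [hS]
    exact fun a ha => hFsub _ _ (hinf n) ha.1
  have hpick (n) : pick (S n) ∈ S n := Nat.sInf_mem (hinf n).nonempty
  have hmono : StrictMono fun n => pick (S n) := strictMono_nat_of_lt_succ fun n => by
    have h := hpick (n + 1)
    rw [hS] at h
    rw [hS]
    exact h.2
  have hM0 : Set.range (fun n => pick (S n)) ⊆ F k N := by
    rintro _ ⟨n, rfl⟩
    exact hanti (Nat.zero_le n) (hpick n)
  refine ⟨Set.range fun n => pick (S n), hM0.trans (hFsub k N hN),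
    Set.infinite_range_of_injective hmono.injective, her _ _ _ (hFP k N hN) hM0, ?_⟩
  rintro _ ⟨n, rfl⟩
  refine her _ _ _ (hFP (pick (S n) + 1) (S n) (hinf n)) ?_
  rintro _ ⟨⟨j, rfl⟩, hj⟩
  have hnj : n + 1 ≤ j := hmono.lt_iff_lt.1 hj
  have h := hanti hnj (hpick j)
  rw [hS] at h
  exact h.1

/-- Fusion for properties indexed by stems. -/
theorem fusion_stem (Q : Finset ℕ → Set ℕ → Prop)
    (her : ∀ t M M', Q t M → above t M' ⊆ M → Q t M')
    (dense : ∀ t M, M.Infinite → ∃ M' ⊆ M, M'.Infinite ∧ Q t M')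
    (s : Finset ℕ) (N : Set ℕ) (hN : N.Infinite) :
    ∃ M ⊆ above s N, M.Infinite ∧ ∀ u : Finset ℕ, (u : Set ℕ) ⊆ M → Q (s ∪ u) M := by
  have her' : ∀ t M M', Q t M → M' ⊆ M → Q t M' :=
    fun t M M' h hM => her t M M' h ((above_subset t M').trans hM)
  obtain ⟨M, hMN, hM, hk, hm⟩ := fusion (fun n M => ∀ t ∈ (Finset.range n).powerset, Q t M)
    (fun n M M' h hM t ht => her' _ _ _ (h t ht) hM)
    (fun n M hM => exists_forall_finset Q her' dense _ M hM)
    (s.sup id + 1) (above s N) (above_infinite s hN)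
  refine ⟨M, hMN, hM, fun u hu => ?_⟩
  have hs : s ⊆ Finset.range (s.sup id + 1) := s.subset_range_sup_succ
  rcases u.eq_empty_or_nonempty with rfl | hne
  · exact hk _ (by simpa using hs)
  · have hmax := u.max'_mem hne
    refine her _ _ _ (hm (u.max' hne) (hu hmax) (s ∪ u) ?_) ?_
    · rw [Finset.mem_powerset]
      intro x hx
      rw [Finset.mem_range]
      rcases Finset.mem_union.1 hx with hx | hx
      · have := (hMN (hu hmax)).2 x hx
        omega
      · have := u.le_max' x hx
        omega
    · exact fun a ha => ⟨ha.1, ha.2 _ (Finset.mem_union_right _ hmax)⟩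

theorem exists_avoids_or_rejects (X : Set InfSet) (t : Finset ℕ) (M : Set ℕ) (hM : M.Infinite) :
    ∃ M' ⊆ M, M'.Infinite ∧ (Avoids X t M' ∨ Rejects X t M') := by
  by_cases h : Rejects X t M
  · exact ⟨M, subset_rfl, hM, .inr h⟩
  · simp only [Rejects, not_forall, not_not] at h
    obtain ⟨M', h1, h2, h3⟩ := h
    exact ⟨M', h1, h2, .inl h3⟩

theorem exists_avoids_or_rejects_succ (X : Set InfSet) (t : Finset ℕ) (N : Set ℕ)
    (hN : N.Infinite) :
    ∃ M ⊆ N, M.Infinite ∧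
      (Avoids X t M ∨ ∀ n ∈ M, (∀ x ∈ t, x < n) → Rejects X (insert n t) M) := by
  obtain ⟨M, hMN, hM, hdec⟩ := fusion_stem (fun t M => Avoids X t M ∨ Rejects X t M)
    (fun t M M' h hM => h.imp (fun h => h.mono hM) fun h => h.mono hM)
    (exists_avoids_or_rejects X) t N hN
  have hdec' (n) (hn : n ∈ M) : Avoids X (insert n t) M ∨ Rejects X (insert n t) M := by
    have h := hdec {n} (by simpa using hn)
    rwa [Finset.union_comm, ← Finset.insert_eq] at h
  by_cases hG : {n ∈ M | Avoids X (insert n t) M}.Infinite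
  · refine ⟨_, fun a ha => (hMN ha.1).1, hG, .inl ?_⟩
    intro A hA htA hall
    have hne : ∃ n, n ∈ A.1 ∧ n ∉ t := by
      obtain ⟨n, hn, hnt⟩ := (A.2.sdiff t.finite_toSet).nonempty
      exact ⟨n, hn, by simpa using hnt⟩
    classical
    obtain ⟨hnA, hnt⟩ := Nat.find_spec hne
    have hmin : ∀ a ∈ A.1, a ∉ t → Nat.find hne ≤ a := fun a ha hat => Nat.find_min' hne ⟨ha, hat⟩
    generalize Nat.find hne = n at hnA hnt hmin
    have hnG := ((hall n hnA).resolve_left hnt).1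
    refine hnG.2 A hA ?_ fun a ha => ?_
    · intro x hx
      rcases Finset.mem_insert.1 (Finset.mem_coe.1 hx) with rfl | hx
      exacts [hnA, htA hx]
    · by_cases hat : a ∈ t
      · exact .inl (Finset.mem_insert_of_mem hat)
      · rcases (hmin a ha hat).eq_or_lt with rfl | hlt
        · exact .inl (Finset.mem_insert_self _ _)
        · obtain ⟨h1, h2⟩ := (hall a ha).resolve_left hat
          refine .inr ⟨h1.1, fun x hx => ?_⟩
          rcases Finset.mem_insert.1 hx with rfl | hx
          exacts [hlt, h2 x hx]
  · refine ⟨M \ {n ∈ M | Avoids X (insert n t) M}, fun a ha => (hMN ha.1).1,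
      hM.sdiff (Set.not_infinite.1 hG), .inr fun n hn _ => ?_⟩
    exact ((hdec' n hn.1).resolve_left fun h => hn.2 ⟨hn.1, h⟩).mono fun a ha => ha.1.1

theorem initSeg_iff {s : Finset ℕ} {A : Set ℕ} :
    InitSeg s A ↔ (s : Set ℕ) ⊆ A ∧ ∀ a ∈ A, a ∈ s ∨ ∀ x ∈ s, x < a := by
  constructor
  · intro h
    have hmem (n : ℕ) : n ∈ s ↔ n ∈ A ∧ (n : WithBot ℕ) ≤ s.max := Set.ext_iff.1 h n
    refine ⟨fun n hn => ((hmem n).1 hn).1, fun a ha => ?_⟩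
    by_cases has : (a : WithBot ℕ) ≤ s.max
    · exact .inl ((hmem a).2 ⟨ha, has⟩)
    · refine .inr fun x hx => ?_
      by_contra! hax
      exact has (le_trans (WithBot.coe_le_coe.2 hax) (Finset.le_max hx))
  · rintro ⟨hs, h⟩
    ext n
    refine ⟨fun hn => ⟨hs hn, Finset.le_max hn⟩, fun ⟨hn, hle⟩ => ?_⟩
    refine (h n hn).resolve_right fun hlt => ?_
    rcases s.eq_empty_or_nonempty with rfl | hne
    · simp at hle
    · rw [← Finset.coe_max' hne] at hle
      have hle' : n ≤ s.max' hne := WithBot.coe_le_coe.1 hle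
      exact (hlt _ (s.max'_mem hne)).not_ge hle'

theorem union_above_mem_seg (s : Finset ℕ) {M : Set ℕ} (hM : M.Infinite) (B : InfSet)
    (hs : (s : Set ℕ) ⊆ B.1) (hMB : M ⊆ B.1) :
    (⟨s ∪ above s M, (above_infinite s hM).mono Set.subset_union_right⟩ : InfSet) ∈ seg s B :=
  ⟨Set.union_subset hs ((above_subset s M).trans hMB),
    initSeg_iff.2 ⟨Set.subset_union_left, fun _ ha => ha.imp id And.right⟩⟩

theorem Nwd.exists_avoids {X : Set InfSet} (hX : Nwd X) (s : Finset ℕ) (N : Set ℕ)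
    (hN : N.Infinite) : ∃ M ⊆ N, M.Infinite ∧ Avoids X s M := by
  by_contra hcon
  have hrej : Rejects X s N := fun M h1 h2 h3 => hcon ⟨M, h1, h2, h3⟩
  obtain ⟨M, hMN, hM, hQ⟩ := fusion_stem
    (fun t M => Avoids X t M ∨ ∀ n ∈ M, (∀ x ∈ t, x < n) → Rejects X (insert n t) M)
    (fun t M M' h hM => h.imp (fun h => h.mono hM) fun h n hn ht =>
      (h n (hM ⟨hn, ht⟩) ht).mono fun a ha =>
        hM ⟨ha.1, fun x hx => ha.2 x (Finset.mem_insert_of_mem hx)⟩)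
    (exists_avoids_or_rejects_succ X) s N hN
  have hall : ∀ u : Finset ℕ, (u : Set ℕ) ⊆ M → Rejects X (s ∪ u) M := by
    intro u
    induction u using Finset.induction_on_max with
    | empty =>
      intro _
      rw [Finset.union_empty]
      exact hrej.mono fun a ha => (hMN ha.1).1
    | insert n u hlt ih =>
      intro hu
      rw [Finset.coe_insert, Set.insert_subset_iff] at hu
      have h := (hQ u hu.2).resolve_left (ih hu.2 M subset_rfl hM) n hu.1
      rw [Finset.union_insert]
      refine h fun x hx => ?_
      rcases Finset.mem_union.1 hx with hx | hx
      exacts [(hMN hu.1).2 x hx, hlt x hx]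
  let B : InfSet := ⟨s ∪ M, hM.mono Set.subset_union_right⟩
  obtain ⟨V, ⟨t, C, rfl⟩, ⟨A, hA⟩, hVU, hVX⟩ := hX (seg s B) ⟨s, B, rfl⟩
    ⟨_, union_above_mem_seg s hM B Set.subset_union_left Set.subset_union_right⟩
  obtain ⟨hAB, hsA⟩ := hVU hA
  obtain ⟨hAC, htA⟩ := hA
  rw [initSeg_iff] at hsA htA
  have hsub : ∀ a ∈ t, a ∉ s → a ∈ M := fun a ha has => (hAB (htA.1 ha)).resolve_left has
  refine hall (t \ s) (fun a ha => ?_) (A.1 \ s) ?_ (A.2.sdiff s.finite_toSet) ?_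
  · rw [Finset.mem_coe, Finset.mem_sdiff] at ha
    exact hsub a ha.1 ha.2
  · exact fun a ha => (hAB ha.1).resolve_left ha.2
  · rw [Finset.union_sdiff_self_eq_union]
    intro D hD hstD hDA
    have hDV : D ∈ seg t C := by
      refine ⟨fun a ha => ?_, initSeg_iff.2 ⟨fun a ha => ?_, fun a ha => ?_⟩⟩
      · rcases hDA a ha with h | h
        · rcases Finset.mem_union.1 h with h | h
          exacts [hAC (hsA.1 h), hAC (htA.1 h)]
        · exact hAC h.1.1
      · exact hstD (Finset.mem_coe.2 (Finset.mem_union_right _ ha))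
      · rcases hDA a ha with h | h
        · rcases Finset.mem_union.1 h with h | h
          exacts [htA.2 a (hsA.1 h), .inl h]
        · exact .inr fun x hx => h.2 x (Finset.mem_union_right _ hx)
    exact Set.eq_empty_iff_forall_notMem.1 hVX D ⟨hDV, hD⟩

theorem Meager.exists_avoids {X : Set InfSet} (hX : Meager X) (s : Finset ℕ) (N : Set ℕ)
    (hN : N.Infinite) : ∃ M ⊆ N, M.Infinite ∧ Avoids X s M := by
  obtain ⟨f, hf, rfl⟩ := hX
  obtain ⟨M, hMN, hM, -, hm⟩ := fusion
    (fun n M => ∀ p ∈ Finset.range n ×ˢ (Finset.range n).powerset, Avoids (f p.1) p.2 M)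
    (fun n M M' h hM p hp => (h p hp).mono ((above_subset _ _).trans hM))
    (fun n M hM => exists_forall_finset (fun p : ℕ × Finset ℕ => Avoids (f p.1) p.2)
      (fun p M M' h hM => h.mono ((above_subset _ _).trans hM))
      (fun p => (hf p.1).exists_avoids p.2) _ M hM)
    0 N hN
  refine ⟨M, hMN, hM, fun A hA hsA hall => ?_⟩
  obtain ⟨i, hi⟩ := Set.mem_iUnion.1 hA
  obtain ⟨m, hmA, hmi⟩ := (above_infinite (insert i s) A.2).nonempty
  have hmM : m ∈ M := ((hall m hmA).resolve_left fun h =>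
    lt_irrefl m (hmi m (Finset.mem_insert_of_mem h))).1
  classical
  have him := hmi i (Finset.mem_insert_self i s)
  refine hm m hmM (i, (Finset.range (m + 1)).filter (· ∈ A.1)) ?_ A hi ?_ fun a ha => ?_
  · simp only [Finset.mem_product, Finset.mem_range, Finset.mem_powerset]
    exact ⟨by omega, Finset.filter_subset _ _⟩
  · intro a ha
    exact (Finset.mem_filter.1 (Finset.mem_coe.1 ha)).2
  · by_cases ham : a ≤ m
    · exact .inl (Finset.mem_filter.2 ⟨Finset.mem_range.2 (by omega), ha⟩)
    · rw [not_le] at ham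
      have has : a ∉ s := fun h => by
        have := hmi a (Finset.mem_insert_of_mem h)
        omega
      refine .inr ⟨⟨((hall a ha).resolve_left has).1, ham⟩, fun x hx => ?_⟩
      have := Finset.mem_range.1 (Finset.mem_filter.1 hx).1
      omega

theorem Meager.isRamseyNull {X : Set InfSet} (hX : Meager X) : IsRamseyNull X := by
  intro N s hs
  obtain ⟨M, hMN, hM, hav⟩ := hX.exists_avoids s N.1 N.2
  refine ⟨⟨s ∪ M, hM.mono Set.subset_union_right⟩, Set.union_subset hs hMN,
    Set.subset_union_left, Set.eq_empty_iff_forall_notMem.2 ?_⟩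
  rintro A ⟨⟨hAM, hsA⟩, hA⟩
  rw [initSeg_iff] at hsA
  refine hav A hA hsA.1 fun a ha => ?_
  by_cases has : a ∈ s
  · exact .inl has
  · exact .inr ⟨(hAM ha).resolve_left has, (hsA.2 a ha).resolve_left has⟩

theorem IsRamseyNull.nwd {X : Set InfSet} (hX : IsRamseyNull X) : Nwd X := by
  rintro _ ⟨s, B, rfl⟩ ⟨A, hAB, hsA⟩
  obtain ⟨M, hMB, hsM, h⟩ := hX B s ((initSeg_iff.1 hsA).1.trans hAB)
  exact ⟨seg s M, ⟨s, M, rfl⟩, ⟨_, union_above_mem_seg s M.2 M hsM subset_rfl⟩,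
    fun D hD => ⟨hD.1.trans hMB, hD.2⟩, h⟩

theorem Nwd.meager {X : Set InfSet} (hX : Nwd X) : Meager X :=
  ⟨fun _ => X, fun _ => hX, (Set.iUnion_const X).symm⟩

/-- **Ellentuck's theorem, part 1.** For any `𝒜 ⊆ [ℕ]^ω`, with respect to the
Ellentuck topology: `𝒜` is Ramsey null iff `𝒜` is nowhere dense iff `𝒜` is meager. -/
theorem ellentuck_part1 (𝒜 : Set InfSet) :
    (IsRamseyNull 𝒜 ↔ Nwd 𝒜) ∧ (Nwd 𝒜 ↔ Meager 𝒜) := by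
  exact ⟨⟨IsRamseyNull.nwd, fun h => h.meager.isRamseyNull⟩, Nwd.meager,
    fun h => h.isRamseyNull.nwd⟩

end Ellentuck
end

section
/- Let (ℛ,≤,r) be a topological Ramsey space. Then axiom A.3*.1 holds if and only if for every nonempty basic open set [a,B] the set of approximations r_{|a|+1}''[a,B] is infinite. Consequently, every strong topological Ramsey space has no isolated points in its Ellentuck topology. -/
open scoped Topology

namespace AbstractTRS

/-- A combinatorial structure `(ℛ, ≤, r)`: a quasi-ordered set `R` of objects together with
approximation mappings `r : R → ℕ → α` and a finitization relation `≤_fin` on approximations. -/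
structure CombStruct (R : Type) (α : Type) where
  le : R → R → Prop
  le_refl : ∀ A, le A A
  le_trans : ∀ {A B C}, le A B → le B C → le A C
  r : R → ℕ → α
  lefin : α → α → Prop

namespace CombStruct

variable {R α : Type} (S : CombStruct R α)

/-- `𝒜ℛ`, the set of all finite approximations. -/
def AR : Set α := {a | ∃ (A : R) (n : ℕ), S.r A n = a}

/-- `𝒜ℛ_n`, the set of all `n`-approximations. -/
def ARn (n : ℕ) : Set α := {a | ∃ A : R, S.r A n = a}

/-- `a ⊑ b` : `a` is an initial segment of `b`. -/
def Init (a b : α) : Prop := ∃ (C : R) (n m : ℕ), n ≤ m ∧ S.r C n = a ∧ S.r C m = b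

/-- `a ⊏ b` : `a` is a proper initial segment of `b`. -/
def PInit (a b : α) : Prop := S.Init a b ∧ a ≠ b

/-- The basic set `[a, B]`, where `na = |a|` is the length of `a`. -/
def seg (a : α) (na : ℕ) (B : R) : Set R := {X | S.le X B ∧ S.r X na = a}

/-- `[n, B] = [r_n(B), B]`. -/
def segN (n : ℕ) (B : R) : Set R := S.seg (S.r B n) n B

/-- `depth_B(a) < ∞`. -/
def hasDepth (B : R) (a : α) : Prop := ∃ n, S.lefin a (S.r B n)

/-- `depth_B(a)` : the minimal `n` with `a ≤_fin r_n(B)` (junk value `0` if there is none). -/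
noncomputable def depth (B : R) (a : α) : ℕ :=
  letI : DecidablePred fun n => S.lefin a (S.r B n) := Classical.decPred _
  letI : Decidable (∃ n, S.lefin a (S.r B n)) := Classical.dec _
  if h : ∃ n, S.lefin a (S.r B n) then Nat.find h else 0

/-- `r_n''[a,B]`, where `na = |a|`. -/
def rimg (n : ℕ) (a : α) (na : ℕ) (B : R) : Set α :=
  {d | ∃ D ∈ S.seg a na B, S.r D n = d}

/-- Axioms A.1 (metrization). -/
def A1 : Prop :=
  (∀ A B : R, S.r A 0 = S.r B 0) ∧
  (∀ A B : R, A ≠ B → ∃ n, S.r A n ≠ S.r B n) ∧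
  (∀ (A B : R) (n m : ℕ), S.r A n = S.r B m → n = m ∧ ∀ k ≤ n, S.r A k = S.r B k)

/-- Axioms A.2 (finitization): `≤_fin` is a quasi-order on `𝒜ℛ` satisfying A.2.1–A.2.3. -/
def A2 : Prop :=
  (∀ a ∈ S.AR, S.lefin a a) ∧
  (∀ a b c : α, S.lefin a b → S.lefin b c → S.lefin a c) ∧
  (∀ b : α, {a : α | S.lefin a b}.Finite) ∧
  (∀ A B : R, S.le A B ↔ ∀ n : ℕ, ∃ m : ℕ, S.lefin (S.r A n) (S.r B m)) ∧
  (∀ a b c : α, S.Init a b → S.lefin b c → ∃ d : α, S.Init d c ∧ S.lefin a d)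

/-- Axioms A.3 (amalgamation). -/
def A3 : Prop :=
  (∀ (a : α) (na : ℕ), a ∈ S.ARn na → ∀ B : R, S.hasDepth B a →
    ∀ A ∈ S.segN (S.depth B a) B, (S.seg a na A).Nonempty) ∧
  (∀ (a : α) (na : ℕ), a ∈ S.ARn na → ∀ A B : R, S.le A B →
    S.hasDepth B a → S.hasDepth A a → S.depth A a ≤ S.depth B a →
    ∃ A' ∈ S.segN (S.depth B a) B, S.seg a na A' ⊆ S.seg a na A)

/-- Axiom A.4 (abstract pigeonhole principle). -/
def A4 : Prop :=
  ∀ (a : α) (na : ℕ), a ∈ S.ARn na → ∀ B : R, S.hasDepth B a →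
    ∀ O : Set α, O ⊆ S.ARn (na + 1) →
      ∃ A ∈ S.segN (S.depth B a) B,
        S.rimg (na + 1) a na A ⊆ O ∨ O ∩ S.rimg (na + 1) a na A = ∅

/-- `⟨b,B⟩_m^A = {X ∈ [b,B] : depth_A(r_{|b|+1}(X)) > m}`, where `nb = |b|`. -/
def angle (b : α) (nb : ℕ) (B A : R) (m : ℕ) : Set R :=
  {X | X ∈ S.seg b nb B ∧ (S.hasDepth A (S.r X (nb + 1)) → m < S.depth A (S.r X (nb + 1)))}

/-- Axiom A.3*.1 (first axiom of strong amalgamation). -/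
def A3star1 : Prop :=
  ∀ (b : α) (nb : ℕ), b ∈ S.ARn nb → ∀ (A : R) (m : ℕ),
    S.hasDepth A b → S.depth A b ≤ m →
    ∀ B ∈ S.segN m A, (S.angle b nb B A m).Nonempty

/-- Axiom A.3*.2 (second axiom of strong amalgamation). -/
def A3star2 : Prop :=
  ∀ (b : α) (nb : ℕ), b ∈ S.ARn nb → ∀ (A B : R) (m : ℕ), S.le B A →
    S.hasDepth A b → S.depth A b ≤ m → S.hasDepth B b → S.depth B b ≤ S.depth A b →
    ∃ B' ∈ S.segN m A, S.angle b nb B' A m ⊆ S.angle b nb B A m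

/-- Axioms A.3* (strong amalgamation). -/
def A3star : Prop := S.A3star1 ∧ S.A3star2

/-- The structure is metrically closed: `ℛ`, identified with the set of sequences
`(r_n(A))_n`, is closed in `α^ℕ` with `α` discrete. -/
def MetricallyClosed : Prop :=
  @IsClosed (ℕ → α) (@Pi.topologicalSpace ℕ (fun _ => α) (fun _ => ⊥))
    {f | ∃ A : R, ∀ n, f n = S.r A n}

/-- The basic (open) sets `[a,B]` of the Ellentuck topology. -/
def IsBasic (U : Set R) : Prop :=
  ∃ (a : α) (na : ℕ) (B : R), a ∈ S.ARn na ∧ U = S.seg a na B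

/-- The Ellentuck topology on `ℛ`, generated by the basic sets `[a,B]`. -/
def ellentuck : TopologicalSpace R :=
  TopologicalSpace.generateFrom {U | S.IsBasic U}

/-- `(ℛ,≤,r)` is a topological Ramsey space. -/
def IsTRS : Prop := S.MetricallyClosed ∧ S.A1 ∧ S.A2 ∧ S.A3 ∧ S.A4

/-- `(ℛ,≤,r)` is a strong topological Ramsey space. -/
def IsStrongTRS : Prop := S.MetricallyClosed ∧ S.A1 ∧ S.A2 ∧ S.A3star ∧ S.A4

/-- `𝒳 ⊆ ℛ` is Ramsey. -/
def RamseySet (X : Set R) : Prop :=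
  ∀ (a : α) (na : ℕ) (A : R), a ∈ S.ARn na → (S.seg a na A).Nonempty →
    ∃ B ∈ S.seg a na A, S.seg a na B ⊆ X ∨ S.seg a na B ∩ X = ∅

/-- `𝒳 ⊆ ℛ` is Ramsey null. -/
def RamseyNull (X : Set R) : Prop :=
  ∀ (a : α) (na : ℕ) (A : R), a ∈ S.ARn na → (S.seg a na A).Nonempty →
    ∃ B ∈ S.seg a na A, S.seg a na B ∩ X = ∅

/-- `𝒳` is nowhere dense (with respect to the basis of the Ellentuck topology). -/
def NwdB (X : Set R) : Prop :=
  ∀ U : Set R, S.IsBasic U → U.Nonempty →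
    ∃ V : Set R, S.IsBasic V ∧ V.Nonempty ∧ V ⊆ U ∧ V ∩ X = ∅

/-- `𝒳` is meager: a countable union of nowhere dense sets. -/
def MeagerB (X : Set R) : Prop :=
  ∃ f : ℕ → Set R, (∀ i, S.NwdB (f i)) ∧ X = ⋃ i, f i

/-- `𝒳` has the abstract Baire property. -/
def ABP (X : Set R) : Prop :=
  ∀ U : Set R, S.IsBasic U → U.Nonempty →
    ∃ V : Set R, S.IsBasic V ∧ V.Nonempty ∧ V ⊆ U ∧ (V ⊆ X ∨ V ∩ X = ∅)

/-- `𝒳` has the Baire property: `𝒳 △ 𝒪` is meager for some open set `𝒪`. -/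
def BP (X : Set R) : Prop :=
  ∃ O : Set R, IsOpen[S.ellentuck] O ∧ S.MeagerB (symmDiff X O)

/-- `ℛ ↾ H = {A ∈ ℛ : A ≤ H}`. -/
def restrict (H : R) : Set R := {A | S.le A H}

/-- `𝒮_b^𝒬 = {D ∈ ℛ : ∅ ≠ [b,D] ⊆ 𝒬}`, where `nb = |b|`. -/
def Sb (Q : Set R) (b : α) (nb : ℕ) : Set R :=
  {D | (S.seg b nb D).Nonempty ∧ S.seg b nb D ⊆ Q}

/-- `D∞` is a diagonalization of the sequence `{D_n}` inside `[a,B]`: for every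
`b ∈ 𝒜ℛ↾[a,D∞]` (with `|b| = nb`) one has `∅ ≠ [b,D∞] ⊆ [b,D_{n_b}]`,
where `n_b = depth_B(b) - depth_B(a)`. -/
def Diag (a : α) (B : R) (D : ℕ → R) (Dinf : R) : Prop :=
  ∀ (b : α) (nb : ℕ), b ∈ S.ARn nb → S.Init a b → S.hasDepth Dinf b →
    (S.seg b nb Dinf).Nonempty ∧
    S.seg b nb Dinf ⊆ S.seg b nb (D (S.depth B b - S.depth B a))

/-- The space is selective: decreasing sequences inside nonempty basic sets admit
diagonalizations. -/
def Selective : Prop :=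
  ∀ (a : α) (na : ℕ) (B : R), a ∈ S.ARn na → (S.seg a na B).Nonempty →
    ∀ D : ℕ → R, (∀ n, D n ∈ S.seg a na B) → (∀ n, S.le (D (n + 1)) (D n)) →
      ∃ Dinf ∈ S.seg a na B, S.Diag a B D Dinf

/-! ### The abstract Kastanas game `𝒢_{[a₀,B₀]}(𝒳)`

Player I plays objects `A 0, A 1, A 2, …` (the paper's `A₁, A₂, …`) and player II answers
with basic sets `[ak (k+1), Bk (k+1)]` (the paper's `[a₁,B₁], [a₂,B₂], …`), where
`ak 0 = a₀` and `Bk 0 = B₀`; `na = |a₀|`, so `|ak k| = na + k`. -/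

/-- The moves of player I induced by a strategy `σ` (which sees II's previous moves). -/
def playI (σ : List (α × R) → R) (ak : ℕ → α) (Bk : ℕ → R) (k : ℕ) : R :=
  σ (List.ofFn fun i : Fin k => (ak (i.1 + 1), Bk (i.1 + 1)))

/-- Rule for player I's k-th move: `A_{k+1} ∈ [a_k, B_k]`. -/
def ruleI (na : ℕ) (ak : ℕ → α) (Bk : ℕ → R) (A : ℕ → R) (k : ℕ) : Prop :=
  A k ∈ S.seg (ak k) (na + k) (Bk k)

/-- Rule for player II's k-th move: `a_k ⊏ a_{k+1}`, `|a_{k+1}| = |a_k| + 1` and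
`B_{k+1} ∈ [a_{k+1}, A_{k+1}]`. -/
def ruleII (na : ℕ) (ak : ℕ → α) (Bk : ℕ → R) (A : ℕ → R) (k : ℕ) : Prop :=
  (∃ C : R, S.r C (na + k) = ak k ∧ S.r C (na + k + 1) = ak (k + 1)) ∧
  ak k ≠ ak (k + 1) ∧
  Bk (k + 1) ∈ S.seg (ak (k + 1)) (na + k + 1) (A k)

/-- The outcome `B∞`, determined by `{B∞} = ⋂ₖ [a_k]`, belongs to `X`. -/
def limitMem (na : ℕ) (ak : ℕ → α) (X : Set R) : Prop :=
  ∀ Binf : R, ({Binf} : Set R) = ⋂ k : ℕ, {Y : R | S.r Y (na + k) = ak k} → Binf ∈ X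

/-- `σ` is a winning strategy for player I in `𝒢_{[a,B₀]}(𝒳)`: it plays legally at every
legal position consistent with it, and every legal play following it is won by player I. -/
def IWinning (X : Set R) (a : α) (na : ℕ) (B0 : R) (σ : List (α × R) → R) : Prop :=
  (∀ (ak : ℕ → α) (Bk : ℕ → R), ak 0 = a → Bk 0 = B0 → ∀ k : ℕ,
      (∀ i < k, S.ruleII na ak Bk (playI σ ak Bk) i) →
      S.ruleI na ak Bk (playI σ ak Bk) k) ∧
  (∀ (ak : ℕ → α) (Bk : ℕ → R), ak 0 = a → Bk 0 = B0 →
      (∀ k : ℕ, S.ruleI na ak Bk (playI σ ak Bk) k ∧ S.ruleII na ak Bk (playI σ ak Bk) k) →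
      S.limitMem na ak X)

/-- First components of player II's moves induced by a strategy `τ`. -/
def playIIa (a : α) (τ : List R → α × R) (A : ℕ → R) : ℕ → α
  | 0 => a
  | k + 1 => (τ (List.ofFn fun i : Fin (k + 1) => A i.1)).1

/-- Second components of player II's moves induced by a strategy `τ`. -/
def playIIB (B0 : R) (τ : List R → α × R) (A : ℕ → R) : ℕ → R
  | 0 => B0
  | k + 1 => (τ (List.ofFn fun i : Fin (k + 1) => A i.1)).2

/-- `τ` is a winning strategy for player II in `𝒢_{[a,B₀]}(𝒳)`: it plays legally at every
legal position consistent with it, and every legal play following it is won by player II. -/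
def IIWinning (X : Set R) (a : α) (na : ℕ) (B0 : R) (τ : List R → α × R) : Prop :=
  (∀ (A : ℕ → R) (k : ℕ),
      (∀ i ≤ k, S.ruleI na (playIIa a τ A) (playIIB B0 τ A) A i) →
      (∀ i < k, S.ruleII na (playIIa a τ A) (playIIB B0 τ A) A i) →
      S.ruleII na (playIIa a τ A) (playIIB B0 τ A) A k) ∧
  (∀ A : ℕ → R,
      (∀ k : ℕ, S.ruleI na (playIIa a τ A) (playIIB B0 τ A) A k ∧
        S.ruleII na (playIIa a τ A) (playIIB B0 τ A) A k) →
      ∀ Binf : R,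
        ({Binf} : Set R) = ⋂ k : ℕ, {Y : R | S.r Y (na + k) = playIIa a τ A k} →
        Binf ∉ X)

section Lemmas

variable {S}

lemma depth_le {B : R} {a : α} {n : ℕ} (h : S.lefin a (S.r B n)) : S.depth B a ≤ n := by
  classical
  have hex : ∃ n, S.lefin a (S.r B n) := ⟨n, h⟩
  rw [depth, dif_pos hex]
  exact Nat.find_le h

lemma lefin_r_depth {B : R} {a : α} (h : S.hasDepth B a) :
    S.lefin a (S.r B (S.depth B a)) := by
  classical
  have hex : ∃ n, S.lefin a (S.r B n) := h
  rw [depth, dif_pos hex]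
  exact Nat.find_spec hex

lemma A2.hasDepth_r (h : S.A2) {X B : R} (hX : S.le X B) (n : ℕ) :
    S.hasDepth B (S.r X n) :=
  (h.2.2.2.1 X B).1 hX n

lemma A2.finite_setOf_depth_le (h : S.A2) (A : R) (m : ℕ) :
    {c : α | S.hasDepth A c ∧ S.depth A c ≤ m}.Finite := by
  refine ((Set.finite_Iic m).biUnion fun k _ => h.2.2.1 (S.r A k)).subset ?_
  rintro c ⟨hc, hcm⟩
  exact Set.mem_biUnion (Set.mem_Iic.2 hcm) (lefin_r_depth hc)

lemma A3star1.infinite_rimg (h : S.A3star1) (h2 : S.A2) {a : α} {na : ℕ} {B : R}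
    (ha : a ∈ S.ARn na) (hne : (S.seg a na B).Nonempty) :
    (S.rimg (na + 1) a na B).Infinite := by
  intro hfin
  obtain ⟨X, hXB, rfl⟩ := hne
  obtain ⟨M, hM⟩ := (hfin.image (S.depth B)).bddAbove
  obtain ⟨Y, hY, hlt⟩ := h _ na ha B (max M (S.depth B (S.r X na)))
    (h2.hasDepth_r hXB na) (le_max_right _ _) B ⟨S.le_refl B, rfl⟩
  have hle : S.depth B (S.r Y (na + 1)) ≤ M := hM ⟨_, ⟨Y, hY, rfl⟩, rfl⟩
  have hlt' := hlt (h2.hasDepth_r hY.1 _)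
  exact absurd (hlt'.trans_le hle) (not_lt.2 (le_max_left _ _))

lemma a3star1_of_infinite_rimg (h1 : S.A1) (h2 : S.A2) (h3 : S.A3)
    (h : ∀ (a : α) (na : ℕ) (B : R), a ∈ S.ARn na → (S.seg a na B).Nonempty →
      (S.rimg (na + 1) a na B).Infinite) : S.A3star1 := by
  rintro b nb hb A m hA hm B ⟨-, hr⟩
  have hAB : S.r B (S.depth A b) = S.r A (S.depth A b) := (h1.2.2 B A m m hr).2 _ hm
  have hB : S.hasDepth B b := ⟨S.depth A b, hAB ▸ lefin_r_depth hA⟩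
  have hne : (S.seg b nb B).Nonempty := h3.1 b nb hb B hB B ⟨S.le_refl B, rfl⟩
  obtain ⟨_, ⟨X, hX, rfl⟩, hlt⟩ :=
    (h b nb B hb hne).exists_notMem_finite (h2.finite_setOf_depth_le A m)
  exact ⟨X, hX, fun hd => not_le.1 fun hle => hlt ⟨hd, hle⟩⟩

lemma A1.seg_r_anti (h : S.A1) (X : R) {m n : ℕ} (hmn : m ≤ n) :
    S.seg (S.r X n) n X ⊆ S.seg (S.r X m) m X :=
  fun Y hY => ⟨hY.1, (h.2.2 Y X n n hY.2).2 m hmn⟩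

lemma A1.exists_seg_subset_of_isOpen (h : S.A1) {U : Set R} (hU : IsOpen[S.ellentuck] U)
    {X : R} (hX : X ∈ U) : ∃ n, S.seg (S.r X n) n X ⊆ U := by
  change TopologicalSpace.GenerateOpen _ U at hU
  induction hU with
  | basic s hs =>
    obtain ⟨a, na, B, -, rfl⟩ := hs
    exact ⟨na, fun Y hY => ⟨S.le_trans hY.1 hX.1, hY.2.trans hX.2⟩⟩
  | univ => exact ⟨0, Set.subset_univ _⟩
  | inter s t _ _ ihs iht =>
    obtain ⟨n, hn⟩ := ihs hX.1
    obtain ⟨k, hk⟩ := iht hX.2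
    exact ⟨max n k, Set.subset_inter ((h.seg_r_anti X (le_max_left _ _)).trans hn)
      ((h.seg_r_anti X (le_max_right _ _)).trans hk)⟩
  | sUnion T _ ih =>
    obtain ⟨s, hs, hXs⟩ := hX
    obtain ⟨n, hn⟩ := ih s hs hXs
    exact ⟨n, hn.trans (Set.subset_sUnion_of_mem hs)⟩

lemma A3star1.not_isOpen_singleton (h : S.A3star1) (h1 : S.A1) (h2 : S.A2) (X : R) :
    ¬ IsOpen[S.ellentuck] ({X} : Set R) := by
  intro hopen
  obtain ⟨n, hn⟩ := h1.exists_seg_subset_of_isOpen hopen rfl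
  refine h.infinite_rimg h2 (a := S.r X n) ⟨X, rfl⟩ ⟨X, S.le_refl X, rfl⟩
    ((Set.finite_singleton (S.r X (n + 1))).subset ?_)
  rintro _ ⟨Y, hY, rfl⟩
  rw [Set.mem_singleton_iff, Set.mem_singleton_iff.1 (hn hY)]

end Lemmas

/-- In a topological Ramsey space, axiom A.3*.1 holds iff for every nonempty
basic set `[a,B]` the set `r_{|a|+1}''[a,B]` is infinite; consequently, every strong
topological Ramsey space has no isolated points in its Ellentuck topology. -/
theorem a3star1_iff_infinite_approximations (S : CombStruct R α) (hTRS : S.IsTRS) :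
    (S.A3star1 ↔ ∀ (a : α) (na : ℕ) (B : R), a ∈ S.ARn na → (S.seg a na B).Nonempty →
        (S.rimg (na + 1) a na B).Infinite) ∧
    (S.A3star → ∀ X : R, ¬ IsOpen[S.ellentuck] ({X} : Set R)) := by
  obtain ⟨-, h1, h2, h3, -⟩ := hTRS
  exact ⟨⟨fun h _ _ _ ha hne => h.infinite_rimg h2 ha hne, a3star1_of_infinite_rimg h1 h2 h3⟩,
    fun h => h.1.not_isOpen_singleton h1 h2⟩

end CombStruct
end AbstractTRS
end

section
/- (Abstract Matet Lemma.) Let (ℛ,≤,r) be a strong topological Ramsey space and let [a,A] ≠ ∅ be a basic open set of ℛ. If {𝒬_i}_{i∈ℕ} is any sequence of subsets of ℛ such that [a,B] ⊄ ⋂_{i∈ℕ} 𝒬_i for all B ∈ [a,A], then there exist i ∈ ℕ and a nonempty basic open set [c,C], with C ∈ [a,A], [c,C] ⊆ [a,A], and |a| ≤ |c| ≤ |a|+i, such that [d,D] ⊄ 𝒬_i for every nonempty basic open set [d,D] with [d,D] ⊆ [c,C]. -/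
open scoped Topology

namespace AbstractTRS

namespace CombStruct

variable {R α : Type} (S : CombStruct R α)

/-! ### Depth and amalgamation in strong topological Ramsey spaces -/

/-- `m` is the depth of `b` in `B`. -/
def IsDepth (B : R) (b : α) (m : ℕ) : Prop :=
  S.lefin b (S.r B m) ∧ ∀ k < m, ¬ S.lefin b (S.r B k)

variable {S}

theorem IsDepth.hasDepth {B : R} {b : α} {m : ℕ} (h : S.IsDepth B b m) : S.hasDepth B b :=
  ⟨m, h.1⟩

theorem IsDepth.depth_eq {B : R} {b : α} {m : ℕ} (h : S.IsDepth B b m) : S.depth B b = m := by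
  classical
  unfold depth
  rw [dif_pos (show ∃ n, S.lefin b (S.r B n) from h.hasDepth)]
  exact (Nat.find_eq_iff _).2 h

theorem exists_isDepth_le {B : R} {b : α} {n : ℕ} (h : S.lefin b (S.r B n)) :
    ∃ m ≤ n, S.IsDepth B b m := by
  classical
  have hex : ∃ n, S.lefin b (S.r B n) := ⟨n, h⟩
  exact ⟨Nat.find hex, Nat.find_min' hex h, Nat.find_spec hex, fun k hk => Nat.find_min hex hk⟩

theorem self_mem_segN (m : ℕ) (B : R) : B ∈ S.segN m B := ⟨S.le_refl B, rfl⟩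

theorem segN_trans {m : ℕ} {A B C : R} (hB : B ∈ S.segN m A) (hC : C ∈ S.segN m B) :
    C ∈ S.segN m A :=
  ⟨S.le_trans hC.1 hB.1, hC.2.trans hB.2⟩

theorem seg_mono {b : α} {nb : ℕ} {B C : R} (h : S.le C B) : S.seg b nb C ⊆ S.seg b nb B :=
  fun _ hX => ⟨S.le_trans hX.1 h, hX.2⟩

theorem r_eq_of_le (h1 : S.A1) {X Y : R} {m k : ℕ} (h : S.r X m = S.r Y m) (hk : k ≤ m) :
    S.r X k = S.r Y k :=
  (h1.2.2 X Y m m h).2 k hk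

theorem seg_r_anti (h1 : S.A1) {Y D : R} {n k : ℕ} (hY : S.le Y D) (hk : k ≤ n) :
    S.seg (S.r Y n) n Y ⊆ S.seg (S.r Y k) k D :=
  fun _ hX => ⟨S.le_trans hX.1 hY, r_eq_of_le h1 hX.2 hk⟩

theorem segN_anti (h1 : S.A1) {m k : ℕ} {A B : R} (hk : k ≤ m) (hB : B ∈ S.segN m A) :
    B ∈ S.segN k A :=
  ⟨hB.1, r_eq_of_le h1 hB.2 hk⟩

theorem IsDepth.of_segN (h1 : S.A1) {A B : R} {b : α} {m k : ℕ} (h : S.IsDepth A b m)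
    (hB : B ∈ S.segN k A) (hm : m ≤ k) : S.IsDepth B b m := by
  refine ⟨?_, fun j hj => ?_⟩
  · rw [r_eq_of_le h1 hB.2 hm]; exact h.1
  · rw [r_eq_of_le h1 hB.2 (hj.le.trans hm)]; exact h.2 j hj

theorem exists_isDepth_of_le (h2 : S.A2) {Y B : R} (h : S.le Y B) (n : ℕ) :
    ∃ m, S.IsDepth B (S.r Y n) m := by
  obtain ⟨k, hk⟩ := (h2.2.2.2.1 Y B).1 h n
  obtain ⟨m, -, hm⟩ := exists_isDepth_le hk
  exact ⟨m, hm⟩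

theorem exists_lefin_r_of_lefin (h1 : S.A1) (h2 : S.A2) {Y B : R} {n n' m : ℕ} (hn : n ≤ n')
    (h : S.lefin (S.r Y n') (S.r B m)) : ∃ k ≤ m, S.lefin (S.r Y n) (S.r B k) := by
  obtain ⟨d, ⟨C, i, j, hij, rfl, hj⟩, hd⟩ := h2.2.2.2.2 _ _ _ ⟨Y, n, n', hn, rfl, rfl⟩ h
  obtain ⟨rfl, hC⟩ := h1.2.2 C B j m hj
  exact ⟨i, hij, hC i hij ▸ hd⟩

theorem IsDepth.mono (h1 : S.A1) (h2 : S.A2) {Y B : R} {n n' m m' : ℕ} (hn : n ≤ n')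
    (h : S.IsDepth B (S.r Y n) m) (h' : S.IsDepth B (S.r Y n') m') : m ≤ m' := by
  obtain ⟨k, hk, hl⟩ := exists_lefin_r_of_lefin h1 h2 hn h'.1
  by_contra! hlt
  exact h.2 k (hk.trans_lt hlt) hl

theorem IsStrongTRS.seg_nonempty (hS : S.IsStrongTRS) {b : α} {nb m : ℕ} {B A : R}
    (hb : b ∈ S.ARn nb) (h : S.lefin b (S.r B m)) (hA : A ∈ S.segN m B) :
    (S.seg b nb A).Nonempty := by
  obtain ⟨k, hk, hd⟩ := exists_isDepth_le h
  obtain ⟨X, hX⟩ := hS.2.2.2.1.1 b nb hb B m hd.hasDepth (hd.depth_eq ▸ hk) A hA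
  exact ⟨X, hX.1⟩

theorem IsStrongTRS.pigeonhole (hS : S.IsStrongTRS) {b : α} {nb m : ℕ} {B : R}
    (hb : b ∈ S.ARn nb) (h : S.IsDepth B b m) (O : Set α) :
    ∃ A ∈ S.segN m B,
      (∀ Y ∈ S.seg b nb A, S.r Y (nb + 1) ∈ O) ∨ ∀ Y ∈ S.seg b nb A, S.r Y (nb + 1) ∉ O := by
  obtain ⟨A, hA, hO⟩ := hS.2.2.2.2 b nb hb B h.hasDepth (O ∩ S.ARn (nb + 1)) Set.inter_subset_right
  rw [h.depth_eq] at hA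
  refine ⟨A, hA, hO.imp (fun h Y hY => (h ⟨Y, hY, rfl⟩).1) fun h Y hY hYO => ?_⟩
  exact h.subset ⟨⟨hYO, ⟨Y, rfl⟩⟩, ⟨Y, hY, rfl⟩⟩

/-- The depth strictly increases along one-step extensions. -/
theorem IsStrongTRS.not_lefin_succ (hS : S.IsStrongTRS) {Y B : R} {n m : ℕ}
    (h : S.IsDepth B (S.r Y n) m) : ¬ S.lefin (S.r Y (n + 1)) (S.r B m) := by
  intro hl
  obtain ⟨A, hA, hO⟩ := hS.pigeonhole ⟨Y, rfl⟩ h {e | S.lefin e (S.r B m)}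
  rcases hO with hO | hO
  · obtain ⟨X, hX, hXm⟩ := hS.2.2.2.1.1 _ n ⟨Y, rfl⟩ B m h.hasDepth h.depth_eq.le A hA
    obtain ⟨k, hk, hd⟩ := exists_isDepth_le (hO X hX)
    have := hXm hd.hasDepth
    rw [hd.depth_eq] at this
    omega
  · obtain ⟨X, hX⟩ := hS.seg_nonempty ⟨Y, rfl⟩ hl hA
    refine hO X ⟨hX.1, r_eq_of_le hS.2.1 hX.2 n.le_succ⟩ ?_
    simpa [hX.2] using hl

theorem IsStrongTRS.length_le_of_lefin (hS : S.IsStrongTRS) {Y B : R} :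
    ∀ {n m : ℕ}, S.lefin (S.r Y n) (S.r B m) → n ≤ m
  | 0, _, _ => Nat.zero_le _
  | n + 1, m, h => by
    obtain ⟨k, hk, hl⟩ := exists_lefin_r_of_lefin hS.2.1 hS.2.2.1 n.le_succ h
    obtain ⟨j, hj, hd⟩ := exists_isDepth_le hl
    have h1 := hS.length_le_of_lefin hd.1
    have h2 : j ≠ m := fun e => hS.not_lefin_succ hd (e ▸ h)
    omega

/-- Amalgamation, without any condition on the depth of `b` in `C`. -/
theorem IsStrongTRS.amalgamation (hS : S.IsStrongTRS) {b : α} {nb m : ℕ} {B C : R}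
    (h : S.IsDepth B b m) (hC : S.le C B) (hne : (S.seg b nb C).Nonempty) :
    ∃ B' ∈ S.segN m B, S.seg b nb B' ⊆ S.seg b nb C := by
  obtain ⟨X, hXC, rfl⟩ := hne
  obtain ⟨k, hk, hd⟩ := exists_isDepth_le (hS.2.2.1.1 (S.r X nb) ⟨X, nb, rfl⟩)
  have hnm : nb ≤ m := hS.length_le_of_lefin h.1
  obtain ⟨B', hB', hsub⟩ := hS.2.2.2.1.2 _ nb ⟨X, rfl⟩ B X m (S.le_trans hXC hC) h.hasDepth
    h.depth_eq.le hd.hasDepth (by rw [hd.depth_eq, h.depth_eq]; omega)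
  refine ⟨B', hB', fun Y hY => seg_mono hXC (hsub ⟨hY, fun hY' => ?_⟩).1⟩
  obtain ⟨n, hn⟩ := hY'
  obtain ⟨j, -, hj⟩ := exists_isDepth_le hn
  rw [hj.depth_eq]
  rw [← hY.2] at h
  have hle : m ≤ j := h.mono hS.2.1 hS.2.2.1 nb.le_succ hj
  exact lt_of_le_of_ne hle fun e => hS.not_lefin_succ h (e ▸ hj.1)

/-! ### Fusion -/

theorem MetricallyClosed.exists_r_eq (hc : S.MetricallyClosed) {f : ℕ → α}
    (hf : ∀ n, ∃ B : R, ∀ k < n, S.r B k = f k) : ∃ A : R, ∀ n, f n = S.r A n := by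
  let _ : TopologicalSpace α := ⊥
  have : DiscreteTopology α := ⟨rfl⟩
  choose B hB using hf
  have hc' : IsClosed {f : ℕ → α | ∃ A : R, ∀ n, f n = S.r A n} := hc
  suffices h : Filter.Tendsto (fun n => S.r (B n)) Filter.atTop (𝓝 f) from
    hc'.mem_of_tendsto h (Filter.Eventually.of_forall fun n => ⟨B n, fun _ => rfl⟩)
  refine tendsto_pi_nhds.2 fun k => tendsto_nhds_of_eventually_eq ?_
  filter_upwards [Filter.eventually_gt_atTop k] with n hn using hB n k hn

theorem IsStrongTRS.exists_limit (hS : S.IsStrongTRS) (m : ℕ) (D : ℕ → R)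
    (hD : ∀ k, D (k + 1) ∈ S.segN (m + k) (D k)) :
    ∃ B : R, ∀ k, B ∈ S.segN (m + k) (D k) := by
  have hD' : ∀ k j, k ≤ j → D j ∈ S.segN (m + k) (D k) := by
    intro k j hkj
    induction j, hkj using Nat.le_induction with
    | base => exact self_mem_segN _ _
    | succ j hj ih => exact segN_trans ih (segN_anti hS.2.1 (by omega) (hD j))
  obtain ⟨B, hB⟩ := hS.1.exists_r_eq (f := fun n => S.r (D n) n) fun n =>
    ⟨D n, fun k hk => r_eq_of_le hS.2.1 (hD' k n hk.le).2 (by omega)⟩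
  have hr : ∀ n j, n ≤ m + j → S.r B n = S.r (D j) n := by
    intro n j hn
    rw [← hB n]
    rcases le_total n j with h | h
    · exact (r_eq_of_le hS.2.1 (hD' n j h).2 (by omega)).symm
    · exact r_eq_of_le hS.2.1 (hD' j n h).2 hn
  refine ⟨B, fun k => ⟨(hS.2.2.1.2.2.2.1 _ _).2 fun n => ?_, hr _ _ le_rfl⟩⟩
  rw [hr n (max n k) (by omega)]
  exact (hS.2.2.1.2.2.2.1 _ _).1 (hD' k (max n k) (le_max_right _ _)).1 n

theorem IsStrongTRS.fusion (hS : S.IsStrongTRS) (P : α → R → Prop) (A : R) (m₀ : ℕ)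
    (hP : ∀ b B m, S.le B A → S.IsDepth B b m → ∃ B' ∈ S.segN m B, P b B')
    (hP' : ∀ b B C, S.le C B → P b B → P b C) :
    ∃ B ∈ S.segN m₀ A, ∀ b m, m₀ ≤ m → S.IsDepth B b m → P b B := by
  have step : ∀ (m : ℕ) (B : R),
      ∃ B' ∈ S.segN m B, S.le B A → ∀ b, S.IsDepth B' b m → P b B' := by
    intro m B
    by_cases hBA : S.le B A
    swap
    · exact ⟨B, self_mem_segN _ _, fun h => absurd h hBA⟩
    have fin : ∀ s : Set α, s.Finite →
        ∃ B' ∈ S.segN m B, ∀ b ∈ s, S.IsDepth B b m → P b B' := by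
      intro s hs
      induction s, hs using Set.Finite.induction_on with
      | empty => exact ⟨B, self_mem_segN _ _, by simp⟩
      | @insert b s _ _ ih =>
        obtain ⟨C, hC, hCs⟩ := ih
        by_cases hb : S.IsDepth B b m
        · obtain ⟨C', hC', hPC⟩ := hP b C m (S.le_trans hC.1 hBA) (hb.of_segN hS.2.1 hC le_rfl)
          refine ⟨C', segN_trans hC hC', fun e he hd => ?_⟩
          rcases he with rfl | he
          · exact hPC
          · exact hP' _ _ _ hC'.1 (hCs e he hd)
        · refine ⟨C, hC, fun e he hd => ?_⟩
          rcases he with rfl | he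
          · exact absurd hd hb
          · exact hCs e he hd
    obtain ⟨B', hB', h⟩ := fin _ (hS.2.2.1.2.2.1 (S.r B m))
    refine ⟨B', hB', fun _ b hb => ?_⟩
    have hb' : S.IsDepth B b m := by
      refine ⟨?_, fun k hk => ?_⟩
      · rw [← hB'.2]; exact hb.1
      · rw [← r_eq_of_le hS.2.1 hB'.2 hk.le]; exact hb.2 k hk
    exact h b hb'.1 hb'
  choose F hF hFP using step
  let D : ℕ → R := fun k => Nat.rec A (fun k B => F (m₀ + k) B) k
  have hD : ∀ k, D (k + 1) = F (m₀ + k) (D k) := fun _ => rfl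
  have hDA : ∀ k, S.le (D k) A := by
    intro k
    induction k with
    | zero => exact S.le_refl A
    | succ k ih => exact S.le_trans (hF _ _).1 ih
  obtain ⟨B, hB⟩ := hS.exists_limit m₀ D fun k => hD k ▸ hF _ _
  refine ⟨B, hB 0, fun b m hm hb => ?_⟩
  obtain ⟨k, rfl⟩ := Nat.exists_eq_add_of_le hm
  have hk := segN_anti hS.2.1 (show m₀ + k ≤ m₀ + (k + 1) by omega) (hB (k + 1))
  refine hP' _ _ _ hk.1 ?_
  rw [hD]
  refine hFP _ _ (hDA k) b ⟨?_, fun j hj => ?_⟩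
  · rw [← hD, ← hk.2]; exact hb.1
  · rw [← hD, ← r_eq_of_le hS.2.1 hk.2 hj.le]; exact hb.2 j hj

/-! ### Sets with dense interior -/

/-- If the Ellentuck interior of `X` is dense below `[c, A]`, then `X` contains `[c, B]` for some
`B ∈ [m, A]`, where `m` is the depth of `c` in `A`. -/
theorem IsStrongTRS.exists_seg_subset (hS : S.IsStrongTRS) (X : Set R) {c : α} {nc m : ℕ} {A : R}
    (hc : c ∈ S.ARn nc) (hd : S.IsDepth A c m)
    (hX : ∀ B ∈ S.segN m A, ∃ Y ∈ S.seg c nc B, ∃ n ≥ nc, S.seg (S.r Y n) n Y ⊆ X) :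
    ∃ B ∈ S.segN m A, S.seg c nc B ⊆ X := by
  have h1 := hS.2.1
  have h2 := hS.2.2.1
  let Rej (b : α) (nb : ℕ) (B : R) : Prop :=
    ∀ C, S.le C B → (S.seg b nb C).Nonempty → ¬ S.seg b nb C ⊆ X
  obtain ⟨B₁, hB₁, hdec⟩ := hS.fusion
    (fun b B => ∀ nb, b ∈ S.ARn nb → S.seg b nb B ⊆ X ∨ Rej b nb B) A m
    (by
      intro b B k _ hb
      by_cases h : ∃ nb, b ∈ S.ARn nb ∧ ¬ Rej b nb B
      · obtain ⟨nb, ⟨Z, rfl⟩, h⟩ := h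
        simp only [Rej] at h
        push Not at h
        obtain ⟨C, hC, hne, hCX⟩ := h
        obtain ⟨B', hB', hsub⟩ := hS.amalgamation hb hC hne
        refine ⟨B', hB', fun n ⟨Z', hZ'⟩ => ?_⟩
        obtain ⟨rfl, -⟩ := h1.2.2 _ _ _ _ hZ'
        exact Or.inl (hsub.trans hCX)
      · push Not at h
        exact ⟨B, self_mem_segN _ _, fun nb hb => Or.inr (h nb hb)⟩)
    (fun b B C hCB h nb hb => (h nb hb).imp (fun h => (seg_mono hCB).trans h)
      fun h D hD => h D (S.le_trans hD hCB))
  have hd₁ := hd.of_segN h1 hB₁ le_rfl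
  rcases hdec c m le_rfl hd₁ nc hc with h | hrej
  · exact ⟨B₁, hB₁, h⟩
  exfalso
  obtain ⟨B₂, hB₂, hB₂P⟩ := hS.fusion
    (fun b B => ∀ nb, b ∈ S.ARn nb → Rej b nb B₁ →
      ∀ Y ∈ S.seg b nb B, ¬ S.seg (S.r Y (nb + 1)) (nb + 1) B₁ ⊆ X) B₁ m
    (by
      intro b B k hle hb
      by_cases h : ∃ nb, b ∈ S.ARn nb ∧ Rej b nb B₁
      · obtain ⟨nb, hnb, hr⟩ := h
        obtain ⟨B', hB', hO⟩ := hS.pigeonhole hnb hb {e | S.seg e (nb + 1) B₁ ⊆ X}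
        rcases hO with hO | hO
        · refine absurd ?_ (hr B' (S.le_trans hB'.1 hle) (hS.seg_nonempty hnb hb.1 hB'))
          exact fun Y hY => hO Y hY ⟨S.le_trans hY.1 (S.le_trans hB'.1 hle), rfl⟩
        · refine ⟨B', hB', fun n ⟨Z', hZ'⟩ _ => ?_⟩
          obtain ⟨Z, hZ⟩ := hnb
          obtain ⟨rfl, -⟩ := h1.2.2 Z Z' nb n (hZ.trans hZ'.symm)
          exact hO
      · exact ⟨B, self_mem_segN _ _, fun nb hb hr => absurd ⟨nb, hb, hr⟩ h⟩)
    (fun b B C hCB h nb hb hr Y hY => h nb hb hr Y (seg_mono hCB hY))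
  have hd₂ := hd₁.of_segN h1 hB₂ le_rfl
  obtain ⟨Y, ⟨hYB, hYc⟩, n, hn, hYX⟩ := hX B₂ (segN_trans hB₁ hB₂)
  have key : ∀ n ≥ nc, Rej (S.r Y n) n B₁ := by
    intro n hn
    induction n, hn using Nat.le_induction with
    | base => rw [hYc]; exact hrej
    | succ n hn ih =>
      rw [← hYc] at hd₁ hd₂
      obtain ⟨k, hk⟩ := exists_isDepth_of_le h2 hYB n
      obtain ⟨j, hj⟩ := exists_isDepth_of_le h2 (S.le_trans hYB hB₂.1) (n + 1)
      refine (hdec _ j (hd₁.mono h1 h2 (by omega) hj) hj _ ⟨Y, rfl⟩).resolve_left ?_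
      exact hB₂P _ k (hd₂.mono h1 h2 hn hk) hk n ⟨Y, rfl⟩ ih Y ⟨hYB, rfl⟩
  exact key n hn Y (S.le_trans hYB hB₂.1) ⟨Y, S.le_refl Y, rfl⟩ hYX

/-- **Abstract Matet Lemma.** Let `(ℛ,≤,r)` be a strong topological Ramsey space
and `[a,A] ≠ ∅` a basic set. If `{𝒬_i}` is a sequence of subsets of `ℛ` such that
`[a,B] ⊄ ⋂ᵢ 𝒬_i` for all `B ∈ [a,A]`, then there are `i ∈ ℕ` and a nonempty basic set
`[c,C]` with `C ∈ [a,A]`, `[c,C] ⊆ [a,A]` and `|a| ≤ |c| ≤ |a| + i`, such that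
`[d,D] ⊄ 𝒬_i` for every nonempty basic set `[d,D] ⊆ [c,C]`. -/
theorem abstract_matet_lemma (S : CombStruct R α) (hS : S.IsStrongTRS)
    (a : α) (na : ℕ) (A : R) (ha : a ∈ S.ARn na) (hane : (S.seg a na A).Nonempty)
    (Q : ℕ → Set R)
    (hQ : ∀ B ∈ S.seg a na A, ¬ S.seg a na B ⊆ ⋂ i, Q i) :
    ∃ (i : ℕ) (c : α) (nc : ℕ) (C : R), c ∈ S.ARn nc ∧ C ∈ S.seg a na A ∧
      (S.seg c nc C).Nonempty ∧ S.seg c nc C ⊆ S.seg a na A ∧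
      na ≤ nc ∧ nc ≤ na + i ∧
      ∀ (d : α) (nd : ℕ) (D : R), d ∈ S.ARn nd → (S.seg d nd D).Nonempty →
        S.seg d nd D ⊆ S.seg c nc C → ¬ S.seg d nd D ⊆ Q i := by
  by_contra! hcon
  have h1 := hS.2.1
  have h2 := hS.2.2.1
  obtain ⟨A₀, hA₀, hA₀a⟩ := hane
  obtain ⟨m₀, hm₀⟩ := exists_isDepth_of_le h2 hA₀ na
  rw [hA₀a] at hm₀
  obtain ⟨B, hB, hBP⟩ := hS.fusion
    (fun b B => ∀ i Y, S.r Y na = a → S.r Y (na + i) = b → S.seg b (na + i) B ⊆ Q i) A m₀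
    (by
      intro b B m hBA hb
      by_cases h : ∃ i Y, S.r Y na = a ∧ S.r Y (na + i) = b
      · obtain ⟨i, Y, hYa, hYb⟩ := h
        obtain ⟨B', hB', hsub⟩ := hS.exists_seg_subset (Q i) (nc := na + i) ⟨Y, hYb⟩ hb (by
          intro B' hB'
          obtain ⟨C, hC⟩ := hS.seg_nonempty (nb := na + i) ⟨Y, hYb⟩ hb.1 hB'
          have hCA : S.le C A := S.le_trans hC.1 (S.le_trans hB'.1 hBA)
          have hCY : ∀ Z, S.r Z (na + i) = b → S.r Z na = a := fun Z hZ =>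
            (r_eq_of_le h1 (hZ.trans hYb.symm) (Nat.le_add_right _ _)).trans hYa
          obtain ⟨d, nd, D, -, ⟨Z, hZ⟩, hDC, hDQ⟩ := hcon i b (na + i) C ⟨Y, hYb⟩
            ⟨hCA, hCY C hC.2⟩ ⟨C, S.le_refl C, hC.2⟩
            (fun Z hZ => ⟨S.le_trans hZ.1 hCA, hCY Z hZ.2⟩) (Nat.le_add_right _ _) le_rfl
          refine ⟨Z, seg_mono hC.1 (hDC hZ), max nd (na + i), le_max_right _ _, ?_⟩
          refine (seg_r_anti h1 hZ.1 (le_max_left nd (na + i))).trans ?_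
          rw [hZ.2]
          exact hDQ)
        refine ⟨B', hB', fun j Z _ hZb => ?_⟩
        obtain rfl : i = j := by
          have := (h1.2.2 _ _ _ _ (hYb.trans hZb.symm)).1
          omega
        exact hsub
      · refine ⟨B, self_mem_segN _ _, fun i Y hYa hYb => absurd ⟨i, Y, hYa, hYb⟩ h⟩)
    (fun b B C hCB h i Y hYa hYb => (seg_mono hCB).trans (h i Y hYa hYb))
  have hmB := hm₀.of_segN h1 hB le_rfl
  obtain ⟨B', hB', hB'a⟩ := hS.seg_nonempty ha hm₀.1 hB
  refine hQ B' ⟨S.le_trans hB' hB.1, hB'a⟩ fun Y ⟨hY, hYa⟩ => Set.mem_iInter.2 fun i => ?_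
  have hYB := S.le_trans hY hB'
  obtain ⟨m, hm⟩ := exists_isDepth_of_le h2 hYB (na + i)
  rw [← hYa] at hmB
  exact hBP _ m (hmB.mono h1 h2 (Nat.le_add_right _ _) hm) hm i Y hYa rfl ⟨hYB, rfl⟩

end CombStruct
end AbstractTRS
end
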